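/- arXiv:2210.02708 — 2 statements merged into one kernel-verified Lean document; each statement's English description precedes it below -/
import Mathlib

section
/- Let (X, G, φ, π) be a pre-crossed module and form the truncated simplicial group X ⋊[φ] G with d₀(x,g) = g, d₁(x,g) = π(x)*g and s₀(g) = (1,g). Then the map ι : X → ker d₀ given by ι(x) = (x, 1) is a group isomorphism onto ker d₀; it intertwines the action φ with conjugation by degenerate elements, i.e. ι(φ(g) x) = s₀(g) * ι(x) * s₀(g)⁻¹ for all g ∈ G and x ∈ X; and d₁(ι(x)) = π(x) for all x ∈ X. (Hence the pre-crossed module recovered from the truncated simplicial group X ⋊[φ] G \rrl G is isomorphic to the original one, which is part of the equivalence between the category of pre-crossed modules and that of simplicial groups truncated to order 1.) -/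
/-- For a pre-crossed module `(X, G, φ, π)` with associated truncated simplicial group
`X ⋊[φ] G` (faces `d₀ (x,g) = g`, `d₁ (x,g) = π x * g`, degeneracy `s₀ g = (1,g)`),
the map `x ↦ (x, 1)` is a group isomorphism of `X` onto `ker d₀`, it intertwines `φ`
with conjugation by the degenerate elements `s₀ g = inr g`, and composing with `d₁`
recovers `π`. -/
theorem precrossed_module_recovered
    {X G : Type*} [Group X] [Group G] (φ : G →* MulAut X) (π : X →* G)
    (hpre : ∀ (g : G) (x : X), π (φ g x) = g * π x * g⁻¹) :
    ∃ e : X ≃* (SemidirectProduct.rightHom : X ⋊[φ] G →* G).ker,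
      (∀ x : X, (e x : X ⋊[φ] G) = ⟨x, 1⟩) ∧
      (∀ (g : G) (x : X), (e (φ g x) : X ⋊[φ] G) =
        SemidirectProduct.inr g * (e x : X ⋊[φ] G) * (SemidirectProduct.inr g)⁻¹) ∧
      (∀ x : X, π (e x : X ⋊[φ] G).left * (e x : X ⋊[φ] G).right = π x) := by
  refine ⟨{ toFun := fun x => ⟨⟨x, 1⟩, rfl⟩
            invFun := fun y => y.1.left
            left_inv := fun x => rfl
            right_inv := ?_
            map_mul' := ?_ }, ?_, ?_, ?_⟩
  · rintro ⟨⟨a, b⟩, h⟩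
    have hb : b = 1 := h
    subst hb
    rfl
  · intro x y
    apply Subtype.ext
    apply SemidirectProduct.ext <;> simp
  · intro x
    rfl
  · intro g x
    apply SemidirectProduct.ext <;> simp
  · intro x
    simp
end

section
/- Let (X, G, φ, π) be a pre-crossed module (X, G groups, φ : G →* MulAut X, π : X →* G with π(φ(g) x) = g π(x) g⁻¹), and let k be a natural number. Consider the group P presented with generating set (X × Fin k) ⊕ G, where the generator corresponding to (x, j) is written (x)_j and the generator corresponding to g ∈ G is written ⟨g⟩, subject to the relations: (x₁)_j * (x₂)_j = (x₁ * x₂)_j for all x₁, x₂ ∈ X and j ∈ Fin k; ⟨g₁⟩ * ⟨g₂⟩ = ⟨g₁ * g₂⟩ for all g₁, g₂ ∈ G; and ⟨g⟩ * (x)_j * ⟨g⟩⁻¹ = (φ(g) x)_j for all g ∈ G, x ∈ X, j ∈ Fin k. Then P is isomorphic to the semidirect product (Monoid.CoprodI (fun _ : Fin k => X)) ⋊ G, where G acts on the free product of k copies of X by applying φ(g) in each free factor, via the isomorphism sending (x)_j to the element of the j-th free factor determined by x (with trivial G-component) and ⟨g⟩ to (1, g). (This is the description of the degree-k component E_k(X,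 G, π) of the universal simplicial envelope of the pre-crossed module as a semidirect product of the free product of k copies of X with G.) -/
/-- The relations of the degree-`k` component `E_k(X, G, π)` of the universal simplicial
envelope of a pre-crossed module, on the generating set `(X × Fin k) ⊕ G`: the generator
`Sum.inl (x, j)` is `(x)_j` and the generator `Sum.inr g` is `⟨g⟩`.  The relations are
`(x₁)_j * (x₂)_j = (x₁ * x₂)_j`, `⟨g₁⟩ * ⟨g₂⟩ = ⟨g₁ * g₂⟩` and
`⟨g⟩ * (x)_j * ⟨g⟩⁻¹ = (φ g x)_j`, written as words equal to `1`. -/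
def envelopeRels {X G : Type*} [Group X] [Group G] (φ : G →* MulAut X) (k : ℕ) :
    Set (FreeGroup ((X × Fin k) ⊕ G)) :=
  {r | (∃ (x₁ x₂ : X) (j : Fin k),
          r = FreeGroup.of (Sum.inl (x₁, j)) * FreeGroup.of (Sum.inl (x₂, j)) *
              (FreeGroup.of (Sum.inl (x₁ * x₂, j)))⁻¹) ∨
       (∃ g₁ g₂ : G,
          r = FreeGroup.of (Sum.inr g₁) * FreeGroup.of (Sum.inr g₂) *
              (FreeGroup.of (Sum.inr (g₁ * g₂)))⁻¹) ∨
       (∃ (g : G) (x : X) (j : Fin k),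
          r = FreeGroup.of (Sum.inr g) * FreeGroup.of (Sum.inl (x, j)) *
              (FreeGroup.of (Sum.inr g))⁻¹ * (FreeGroup.of (Sum.inl (φ g x, j)))⁻¹)}

/-- The degree-`k` component of the universal simplicial envelope of a pre-crossed module
`(X, G, φ, π)`: the group presented by generators `(x)_j` (`x ∈ X`, `j < k`) and `⟨g⟩`
(`g ∈ G`) with relations `(x₁)_j (x₂)_j = (x₁ x₂)_j`, `⟨g₁⟩⟨g₂⟩ = ⟨g₁ g₂⟩`,
`⟨g⟩ (x)_j ⟨g⟩⁻¹ = (φ g x)_j` is isomorphic to the semidirect product of the free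
product of `k` copies of `X` with `G`, where `G` acts by `φ g` on each free factor,
via `(x)_j ↦ (of x in factor j, 1)` and `⟨g⟩ ↦ (1, g)`. -/
theorem envelope_component_iso
    {X G : Type*} [Group X] [Group G] (φ : G →* MulAut X) (π : X →* G)
    (hpre : ∀ (g : G) (x : X), π (φ g x) = g * π x * g⁻¹) (k : ℕ)
    (Φ : G →* MulAut (Monoid.CoprodI (fun _ : Fin k => X)))
    (hΦ : ∀ (g : G) (j : Fin k) (x : X),
        Φ g (Monoid.CoprodI.of (i := j) x) = Monoid.CoprodI.of (i := j) (φ g x)) :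
    ∃ e : PresentedGroup (envelopeRels φ k) ≃*
        (Monoid.CoprodI (fun _ : Fin k => X)) ⋊[Φ] G,
      (∀ (x : X) (j : Fin k),
        e (PresentedGroup.of (Sum.inl (x, j))) = ⟨Monoid.CoprodI.of (i := j) x, 1⟩) ∧
      (∀ g : G, e (PresentedGroup.of (Sum.inr g)) = ⟨1, g⟩) := by
  classical
  have hinl : ∀ (x : X) (j : Fin k),
      (⟨Monoid.CoprodI.of (M := fun _ : Fin k => X) (i := j) x, 1⟩ :
        (Monoid.CoprodI (fun _ : Fin k => X)) ⋊[Φ] G) =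
      SemidirectProduct.inl (Monoid.CoprodI.of (M := fun _ : Fin k => X) (i := j) x) :=
    fun _ _ => rfl
  have hinr : ∀ g : G, (⟨1, g⟩ : (Monoid.CoprodI (fun _ : Fin k => X)) ⋊[Φ] G) =
      SemidirectProduct.inr g := fun _ => rfl
  -- the forward map
  let f : (X × Fin k) ⊕ G → (Monoid.CoprodI (fun _ : Fin k => X)) ⋊[Φ] G :=
    Sum.elim (fun p => SemidirectProduct.inl
      (Monoid.CoprodI.of (M := fun _ : Fin k => X) (i := p.2) p.1))
      (fun g => SemidirectProduct.inr g)
  have hf : ∀ r ∈ envelopeRels φ k, FreeGroup.lift f r = 1 := by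
    rintro r (⟨x₁, x₂, j, rfl⟩ | ⟨g₁, g₂, rfl⟩ | ⟨g, x, j, rfl⟩)
    · simp [f]
    · simp [f]
    · simp only [map_mul, map_inv, FreeGroup.lift_apply_of, f, Sum.elim_inl, Sum.elim_inr]
      rw [mul_inv_eq_one, ← hΦ, SemidirectProduct.inl_aut, map_inv]
  let F : PresentedGroup (envelopeRels φ k) →* (Monoid.CoprodI (fun _ : Fin k => X)) ⋊[Φ] G :=
    PresentedGroup.toGroup hf
  -- relations in the presented group
  have r1 : ∀ (x₁ x₂ : X) (j : Fin k),
      (PresentedGroup.of (Sum.inl (x₁ * x₂, j)) : PresentedGroup (envelopeRels φ k)) =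
        PresentedGroup.of (Sum.inl (x₁, j)) * PresentedGroup.of (Sum.inl (x₂, j)) := by
    intro x₁ x₂ j
    have := PresentedGroup.one_of_mem (rels := envelopeRels φ k) (Or.inl ⟨x₁, x₂, j, rfl⟩)
    rw [map_mul, map_inv, mul_inv_eq_one, map_mul] at this
    exact this.symm
  have r2 : ∀ (g₁ g₂ : G),
      (PresentedGroup.of (Sum.inr (g₁ * g₂)) : PresentedGroup (envelopeRels φ k)) =
        PresentedGroup.of (Sum.inr g₁) * PresentedGroup.of (Sum.inr g₂) := by
    intro g₁ g₂
    have := PresentedGroup.one_of_mem (rels := envelopeRels φ k)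
      (Or.inr (Or.inl ⟨g₁, g₂, rfl⟩))
    rw [map_mul, map_inv, mul_inv_eq_one, map_mul] at this
    exact this.symm
  have r3 : ∀ (g : G) (x : X) (j : Fin k),
      (PresentedGroup.of (Sum.inl (φ g x, j)) : PresentedGroup (envelopeRels φ k)) =
        PresentedGroup.of (Sum.inr g) * PresentedGroup.of (Sum.inl (x, j)) *
          (PresentedGroup.of (Sum.inr g))⁻¹ := by
    intro g x j
    have := PresentedGroup.one_of_mem (rels := envelopeRels φ k)
      (Or.inr (Or.inr ⟨g, x, j, rfl⟩))
    rw [map_mul, map_inv, mul_inv_eq_one, map_mul, map_mul, map_inv] at this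
    exact this.symm
  let a : Monoid.CoprodI (fun _ : Fin k => X) →* PresentedGroup (envelopeRels φ k) :=
    Monoid.CoprodI.lift (fun j => MonoidHom.mk' (fun x => PresentedGroup.of (Sum.inl (x, j)))
      (fun x y => r1 x y j))
  have ha : ∀ (j : Fin k) (x : X), a (Monoid.CoprodI.of (M := fun _ : Fin k => X) (i := j) x) =
      PresentedGroup.of (Sum.inl (x, j)) := by
    intro j x
    simp [a]
  let b : G →* PresentedGroup (envelopeRels φ k) :=
    MonoidHom.mk' (fun g => PresentedGroup.of (Sum.inr g)) r2
  have hb : ∀ g, b g = PresentedGroup.of (Sum.inr g) := fun _ => rfl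
  let B : (Monoid.CoprodI (fun _ : Fin k => X)) ⋊[Φ] G →* PresentedGroup (envelopeRels φ k) :=
    SemidirectProduct.lift a b (by
      intro g
      refine Monoid.CoprodI.ext_hom _ _ (fun j => MonoidHom.ext fun x => ?_)
      change a (Φ g (Monoid.CoprodI.of (M := fun _ : Fin k => X) (i := j) x)) =
        b g * a (Monoid.CoprodI.of (M := fun _ : Fin k => X) (i := j) x) * (b g)⁻¹
      rw [hΦ, ha, ha, hb, r3])
  have hFl : ∀ (x : X) (j : Fin k), F (PresentedGroup.of (Sum.inl (x, j))) =
      SemidirectProduct.inl (Monoid.CoprodI.of (M := fun _ : Fin k => X) (i := j) x) :=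
    fun x j => PresentedGroup.toGroup.of hf
  have hFr : ∀ g : G, F (PresentedGroup.of (Sum.inr g)) = SemidirectProduct.inr g :=
    fun g => PresentedGroup.toGroup.of hf
  have h1 : B.comp F = MonoidHom.id _ := by
    refine PresentedGroup.ext ?_
    rintro (⟨x, j⟩ | g)
    · rw [MonoidHom.comp_apply, hFl]
      simp only [B, SemidirectProduct.lift_inl, ha, MonoidHom.id_apply]
    · rw [MonoidHom.comp_apply, hFr]
      simp only [B, SemidirectProduct.lift_inr, hb, MonoidHom.id_apply]
  have h2 : F.comp B = MonoidHom.id _ := by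
    refine SemidirectProduct.hom_ext ?_ ?_
    · refine Monoid.CoprodI.ext_hom _ _ (fun j => MonoidHom.ext fun x => ?_)
      simp only [MonoidHom.comp_apply, B, SemidirectProduct.lift_inl, MonoidHom.id_apply]
      rw [ha, hFl]
    · refine MonoidHom.ext fun g => ?_
      simp only [MonoidHom.comp_apply, B, SemidirectProduct.lift_inr, MonoidHom.id_apply]
      rw [hb, hFr]
  exact ⟨MonoidHom.toMulEquiv F B h1 h2, hFl, hFr⟩
end
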